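/- arXiv:1004.0432 — 10 statements merged into one kernel-verified Lean document; each statement's English description precedes it below -/
import Mathlib

section
/- Let f, g : Fin n → ℝ with ∑ᵢ fᵢ = 1, ∑ᵢ gᵢ = 1, fᵢ > 0 and gᵢ ≥ 0 for all i, and suppose x̄_f ≠ x̄_g. Let u := (x̄_g − x̄_f)/‖x̄_g − x̄_f‖. Then for every e > 0 and every a ∈ E with ‖a − x̄_f‖ = e, one has δ(x̄_f + e • u) ≤ δ(a) ≤ δ(x̄_f − e • u); that is, on the sphere of radius e around x̄_f, the relative dispersion is minimized at the point in the direction of x̄_g and maximized at the antipodal point. -/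
open Finset

noncomputable def centroid {E : Type*} [NormedAddCommGroup E] [InnerProductSpace ℝ E]
    {n : ℕ} (x : Fin n → E) (w : Fin n → ℝ) : E :=
  ∑ i, w i • x i

noncomputable def inertiaAt {E : Type*} [NormedAddCommGroup E] [InnerProductSpace ℝ E]
    {n : ℕ} (x : Fin n → E) (w : Fin n → ℝ) (a : E) : ℝ :=
  ∑ i, w i * ‖x i - a‖ ^ 2

noncomputable def inertia {E : Type*} [NormedAddCommGroup E] [InnerProductSpace ℝ E]
    {n : ℕ} (x : Fin n → E) (w : Fin n → ℝ) : ℝ :=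
  inertiaAt x w (centroid x w)

noncomputable def relDisp {E : Type*} [NormedAddCommGroup E] [InnerProductSpace ℝ E]
    {n : ℕ} (x : Fin n → E) (g f : Fin n → ℝ) (a : E) : ℝ :=
  inertiaAt x g a / inertiaAt x f a

theorem inertiaAt_eq_add_norm_sub_sq {E : Type*} [NormedAddCommGroup E] [InnerProductSpace ℝ E]
    {n : ℕ} (x : Fin n → E) (w : Fin n → ℝ) (hw : ∑ i, w i = 1) (a c : E) :
    inertiaAt x w a =
      inertiaAt x w c - 2 * inner ℝ (centroid x w - c) (a - c) + ‖a - c‖ ^ 2 := by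
  have hc : centroid x w - c = ∑ i, w i • (x i - c) := by
    simp [_root_.centroid, smul_sub, Finset.sum_sub_distrib, ← Finset.sum_smul, hw]
  have hs : ‖a - c‖ ^ 2 = ∑ i, w i * ‖a - c‖ ^ 2 := by
    rw [← Finset.sum_mul, hw, one_mul]
  rw [hc, hs, sum_inner, inertiaAt, inertiaAt, Finset.mul_sum, ← Finset.sum_sub_distrib,
    ← Finset.sum_add_distrib]
  refine Finset.sum_congr rfl fun i _ => ?_
  rw [← sub_sub_sub_cancel_right (x i) a c, norm_sub_sq_real, real_inner_smul_left]
  ring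

/-- On a sphere around the centroid of `f`, the relative dispersion decreases as the component
in the direction of the centroid of `g` grows. -/
theorem relDisp_le_of_inner_le {E : Type*} [NormedAddCommGroup E] [InnerProductSpace ℝ E]
    {n : ℕ} (x : Fin n → E) (f g : Fin n → ℝ)
    (hf : ∑ i, f i = 1) (hg : ∑ i, g i = 1) (hfnonneg : ∀ i, 0 ≤ f i) {a b : E}
    (hnorm : ‖b - centroid x f‖ = ‖a - centroid x f‖)
    (hinner : inner ℝ (centroid x g - centroid x f) (a - centroid x f) ≤
      inner ℝ (centroid x g - centroid x f) (b - centroid x f)) :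
    relDisp x g f b ≤ relDisp x g f a := by
  have hfab : inertiaAt x f b = inertiaAt x f a := by
    rw [inertiaAt_eq_add_norm_sub_sq x f hf b (centroid x f),
      inertiaAt_eq_add_norm_sub_sq x f hf a (centroid x f), hnorm]
    simp
  have hpos : 0 ≤ inertiaAt x f a :=
    Finset.sum_nonneg fun i _ => mul_nonneg (hfnonneg i) (sq_nonneg _)
  rw [relDisp, relDisp, hfab]
  refine div_le_div_of_nonneg_right ?_ hpos
  rw [inertiaAt_eq_add_norm_sub_sq x g hg b (centroid x f),
    inertiaAt_eq_add_norm_sub_sq x g hg a (centroid x f), hnorm]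
  linarith

/-- On the sphere of radius `e` around the overall centroid `x̄_f`, the relative dispersion
is minimized at the point in the direction of the group centroid `x̄_g` and maximized at the
antipodal point. -/
theorem relDisp_sphere_extrema {E : Type*} [NormedAddCommGroup E] [InnerProductSpace ℝ E]
    {n : ℕ} (x : Fin n → E) (f g : Fin n → ℝ)
    (hf : ∑ i, f i = 1) (hg : ∑ i, g i = 1)
    (hfpos : ∀ i, 0 < f i) (hgnonneg : ∀ i, 0 ≤ g i)
    (hne : centroid x f ≠ centroid x g) :
    ∀ e : ℝ, 0 < e → ∀ a : E, ‖a - centroid x f‖ = e →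
      relDisp x g f (centroid x f +
          e • (‖centroid x g - centroid x f‖⁻¹ • (centroid x g - centroid x f))) ≤
        relDisp x g f a ∧
      relDisp x g f a ≤
        relDisp x g f (centroid x f -
          e • (‖centroid x g - centroid x f‖⁻¹ • (centroid x g - centroid x f))) := by
  intro e he a ha
  have hd : ‖centroid x g - centroid x f‖ ≠ 0 := norm_ne_zero_iff.2 (sub_ne_zero.2 hne.symm)
  have hu : ‖e • (‖centroid x g - centroid x f‖⁻¹ • (centroid x g - centroid x f))‖ = e := by
    rw [norm_smul, norm_smul, norm_inv, norm_norm, inv_mul_cancel₀ hd, mul_one,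
      Real.norm_of_nonneg he.le]
  have hi : inner ℝ (centroid x g - centroid x f)
      (e • (‖centroid x g - centroid x f‖⁻¹ • (centroid x g - centroid x f))) =
      ‖centroid x g - centroid x f‖ * e := by
    rw [real_inner_smul_right, real_inner_smul_right, real_inner_self_eq_norm_sq]
    field_simp
  have hcs := abs_le.1 (abs_real_inner_le_norm (centroid x g - centroid x f) (a - centroid x f))
  rw [ha] at hcs
  have hfnonneg : ∀ i, 0 ≤ f i := fun i => (hfpos i).le
  constructor
  · apply relDisp_le_of_inner_le x f g hf hg hfnonneg
    · rw [add_sub_cancel_left, hu, ha]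
    · rw [add_sub_cancel_left, hi]
      exact hcs.2
  · apply relDisp_le_of_inner_le x f g hf hg hfnonneg
    · rw [sub_sub_cancel_left, norm_neg, hu, ha]
    · rw [sub_sub_cancel_left, inner_neg_right, hi]
      exact hcs.1
end

section
/- (In-focus point) Let f, g : Fin n → ℝ with ∑ᵢ fᵢ = 1, ∑ᵢ gᵢ = 1, fᵢ > 0 and gᵢ ≥ 0 for all i, and suppose D_{fg} := ‖x̄_f − x̄_g‖² > 0. Set b := Δ_f − Δ_g − D_{fg} and ε₋ := (b − √(b² + 4 Δ_f D_{fg}))/(2 D_{fg}), and let a₋ := x̄_f + ε₋ • (x̄_f − x̄_g). Then a₋ is the unique global minimizer of the relative dispersion: δ(a₋) < δ(a) for every a ∈ E with a ≠ a₋. -/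
open Finset

/-- The parallel axis theorem for weights of total mass one. -/
theorem inertiaAt_eq_inertia_add {E : Type*} [NormedAddCommGroup E] [InnerProductSpace ℝ E]
    {n : ℕ} (x : Fin n → E) (w : Fin n → ℝ) (hw : ∑ i, w i = 1) (a : E) :
    inertiaAt x w a = inertia x w + ‖a - centroid x w‖ ^ 2 := by
  have hzero : ∑ i, w i • (x i - centroid x w) = 0 := by
    simp [smul_sub, Finset.sum_sub_distrib, ← Finset.sum_smul, hw, _root_.centroid]
  have hinner : ∑ i, w i * inner ℝ (x i - centroid x w) (a - centroid x w) = 0 := by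
    simpa [sum_inner, real_inner_smul_left] using
      congrArg (fun y => inner ℝ y (a - centroid x w)) hzero
  have hterm : ∀ i, w i * ‖x i - a‖ ^ 2 = w i * ‖x i - centroid x w‖ ^ 2
      - 2 * (w i * inner ℝ (x i - centroid x w) (a - centroid x w))
      + w i * ‖a - centroid x w‖ ^ 2 := by
    intro i
    rw [← sub_sub_sub_cancel_right (x i) a (centroid x w), norm_sub_sq_real]
    ring
  simp only [inertia, inertiaAt]
  rw [Finset.sum_congr rfl fun i _ => hterm i, Finset.sum_add_distrib, Finset.sum_sub_distrib,
    ← Finset.mul_sum, hinner, ← Finset.sum_mul, hw]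
  ring

theorem inertia_pos_of_centroid_ne {E : Type*} [NormedAddCommGroup E] [InnerProductSpace ℝ E]
    {n : ℕ} (x : Fin n → E) (f g : Fin n → ℝ) (hg : ∑ i, g i = 1) (hfpos : ∀ i, 0 < f i)
    (hne : centroid x f ≠ centroid x g) : 0 < inertia x f := by
  have hnonneg : ∀ i ∈ Finset.univ, 0 ≤ f i * ‖x i - centroid x f‖ ^ 2 :=
    fun i _ => mul_nonneg (hfpos i).le (sq_nonneg _)
  refine lt_of_le_of_ne (Finset.sum_nonneg hnonneg) fun h => hne ?_
  have hx : ∀ i, x i = centroid x f := by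
    intro i
    have hi := (Finset.sum_eq_zero_iff_of_nonneg hnonneg).1 h.symm i (Finset.mem_univ i)
    simpa [(hfpos i).ne', sub_eq_zero] using hi
  calc centroid x f = ∑ i, g i • centroid x f := by rw [← Finset.sum_smul, hg, one_smul]
    _ = centroid x g := Finset.sum_congr rfl fun i _ => by rw [← hx i]

theorem quadratic_smaller_root {F D : ℝ} (hF : 0 < F) (hD : 0 < D) (b : ℝ) :
    (b - Real.sqrt (b ^ 2 + 4 * F * D)) / (2 * D) < 0 ∧
      D * ((b - Real.sqrt (b ^ 2 + 4 * F * D)) / (2 * D)) ^ 2 =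
        b * ((b - Real.sqrt (b ^ 2 + 4 * F * D)) / (2 * D)) + F := by
  have hFD := mul_pos hF hD
  constructor
  · refine div_neg_of_neg_of_pos (sub_neg.2 (Real.lt_sqrt_of_sq_lt ?_)) (by positivity)
    linarith
  · have hs := Real.sq_sqrt (show 0 ≤ b ^ 2 + 4 * F * D by nlinarith [sq_nonneg b])
    generalize Real.sqrt (b ^ 2 + 4 * F * D) = s at hs ⊢
    field_simp
    linear_combination hs

/-- The in-focus point `a₋ = x̄_f + ε₋ (x̄_f − x̄_g)`, with
`ε₋ = (b − √(b² + 4 Δ_f D_{fg}))/(2 D_{fg})` and `b = Δ_f − Δ_g − D_{fg}`, is the unique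
global minimizer of the relative dispersion. -/
theorem inFocus_unique_min {E : Type*} [NormedAddCommGroup E] [InnerProductSpace ℝ E]
    {n : ℕ} (x : Fin n → E) (f g : Fin n → ℝ)
    (hf : ∑ i, f i = 1) (hg : ∑ i, g i = 1)
    (hfpos : ∀ i, 0 < f i) (hgnonneg : ∀ i, 0 ≤ g i)
    (hD : 0 < ‖centroid x f - centroid x g‖ ^ 2) :
    ∀ a : E,
      a ≠ centroid x f +
        (((inertia x f - inertia x g - ‖centroid x f - centroid x g‖ ^ 2) -
            Real.sqrt ((inertia x f - inertia x g - ‖centroid x f - centroid x g‖ ^ 2) ^ 2 +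
              4 * inertia x f * ‖centroid x f - centroid x g‖ ^ 2)) /
          (2 * ‖centroid x f - centroid x g‖ ^ 2)) • (centroid x f - centroid x g) →
      relDisp x g f (centroid x f +
        (((inertia x f - inertia x g - ‖centroid x f - centroid x g‖ ^ 2) -
            Real.sqrt ((inertia x f - inertia x g - ‖centroid x f - centroid x g‖ ^ 2) ^ 2 +
              4 * inertia x f * ‖centroid x f - centroid x g‖ ^ 2)) /
          (2 * ‖centroid x f - centroid x g‖ ^ 2)) • (centroid x f - centroid x g)) <
        relDisp x g f a := by
  intro a ha
  have hF : 0 < inertia x f := by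
    refine inertia_pos_of_centroid_ne x f g hg hfpos fun h => ?_
    simp [h] at hD
  obtain ⟨hneg, hroot⟩ := quadratic_smaller_root hF hD
    (inertia x f - inertia x g - ‖centroid x f - centroid x g‖ ^ 2)
  generalize ((inertia x f - inertia x g - ‖centroid x f - centroid x g‖ ^ 2) -
    Real.sqrt ((inertia x f - inertia x g - ‖centroid x f - centroid x g‖ ^ 2) ^ 2 +
      4 * inertia x f * ‖centroid x f - centroid x g‖ ^ 2)) /
        (2 * ‖centroid x f - centroid x g‖ ^ 2) = ε at *
  -- The key identity: completing the square around the in-focus point.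
  have key : ∀ c : E, (ε + 1) * inertiaAt x f c - ε * inertiaAt x g c =
      ‖c - (centroid x f + ε • (centroid x f - centroid x g))‖ ^ 2 := by
    intro c
    rw [inertiaAt_eq_inertia_add x f hf, inertiaAt_eq_inertia_add x g hg,
      ← sub_add_sub_cancel c (centroid x f) (centroid x g), ← sub_sub c, norm_add_sq_real,
      norm_sub_sq_real (c - centroid x f), real_inner_smul_right, norm_smul, mul_pow,
      Real.norm_eq_abs, sq_abs]
    linear_combination -hroot
  have hpos : ∀ c : E, 0 < inertiaAt x f c := by
    intro c
    rw [inertiaAt_eq_inertia_add x f hf]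
    positivity
  have hsq : 0 < ‖a - (centroid x f + ε • (centroid x f - centroid x g))‖ ^ 2 :=
    pow_pos (norm_pos_iff.2 (sub_ne_zero.2 ha)) 2
  have hmin := key (centroid x f + ε • (centroid x f - centroid x g))
  rw [sub_self, norm_zero, zero_pow two_ne_zero] at hmin
  have hval : relDisp x g f (centroid x f + ε • (centroid x f - centroid x g)) =
      (ε + 1) / ε := by
    rw [relDisp, div_eq_div_iff (hpos _).ne' hneg.ne]
    linarith
  rw [hval, relDisp, div_lt_iff_of_neg hneg, div_mul_eq_mul_div, div_lt_iff₀ (hpos a)]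
  linarith [key a]
end

section
/- Let f, g : Fin n → ℝ with ∑ᵢ fᵢ = 1, ∑ᵢ gᵢ = 1, fᵢ > 0 and gᵢ ≥ 0 for all i, and suppose Δ_f > 0. Then the relative dispersion tends to 1 at infinity: δ(a) → 1 as ‖a‖ → ∞ (i.e. the function a ↦ δ(a) tends to 1 along the filter of complements of bounded sets in E). -/
open Finset

theorem tendsto_norm_sub_div_norm_cobounded {E : Type*} [NormedAddCommGroup E] (x : E) :
    Filter.Tendsto (fun a : E => ‖x - a‖ / ‖a‖) (Bornology.cobounded E) (nhds 1) := by
  rw [tendsto_iff_norm_sub_tendsto_zero]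
  have hlim : Filter.Tendsto (fun a : E => ‖x‖ / ‖a‖) (Bornology.cobounded E) (nhds 0) :=
    tendsto_norm_cobounded_atTop.const_div_atTop ‖x‖
  refine squeeze_zero' (Filter.Eventually.of_forall fun a => norm_nonneg _) ?_ hlim
  filter_upwards [tendsto_norm_cobounded_atTop.eventually_gt_atTop 0] with a ha
  rw [div_sub_one ha.ne', norm_div, norm_norm, Real.norm_eq_abs]
  gcongr
  simpa [norm_sub_rev] using abs_norm_sub_norm_le (x - a) (-a)

theorem tendsto_inertiaAt_div_norm_sq_cobounded {E : Type*} [NormedAddCommGroup E]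
    [InnerProductSpace ℝ E] {n : ℕ} (x : Fin n → E) (w : Fin n → ℝ) :
    Filter.Tendsto (fun a : E => inertiaAt x w a / ‖a‖ ^ 2) (Bornology.cobounded E)
      (nhds (∑ i, w i)) := by
  have h : Filter.Tendsto (fun a : E => ∑ i, w i * (‖x i - a‖ / ‖a‖) ^ 2)
      (Bornology.cobounded E) (nhds (∑ i, w i * 1 ^ 2)) :=
    tendsto_finsetSum _ fun i _ =>
      ((tendsto_norm_sub_div_norm_cobounded (x i)).pow 2).const_mul (w i)
  simpa only [inertiaAt, Finset.sum_div, div_pow, mul_div_assoc, one_pow, mul_one] using h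

/-- The relative dispersion tends to 1 along the filter of complements of bounded sets
(i.e. as `‖a‖ → ∞`). -/
theorem relDisp_tendsto_one_cobounded {E : Type*} [NormedAddCommGroup E]
    [InnerProductSpace ℝ E] {n : ℕ} (x : Fin n → E) (f g : Fin n → ℝ)
    (hf : ∑ i, f i = 1) (hg : ∑ i, g i = 1)
    (hfpos : ∀ i, 0 < f i) (hgnonneg : ∀ i, 0 ≤ g i)
    (hΔf : 0 < inertia x f) :
    Filter.Tendsto (fun a : E => relDisp x g f a) (Bornology.cobounded E) (nhds 1) := by
  have h := (tendsto_inertiaAt_div_norm_sq_cobounded x g).div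
    (tendsto_inertiaAt_div_norm_sq_cobounded x f) (by simp [hf])
  rw [hf, hg, div_one] at h
  refine h.congr' ?_
  filter_upwards [tendsto_norm_cobounded_atTop.eventually_gt_atTop 0] with a ha
  exact div_div_div_cancel_right₀ (pow_pos ha 2).ne' _ _
end

section
/- (Polarization of the in-focus) Let f, g : Fin n → ℝ with ∑ᵢ fᵢ = 1, ∑ᵢ gᵢ = 1, fᵢ > 0 and gᵢ ≥ 0 for all i, and suppose D_{fg} := ‖x̄_f − x̄_g‖² > 0. Set b := Δ_f − Δ_g − D_{fg} and ε₋ := (b − √(b² + 4 Δ_f D_{fg}))/(2 D_{fg}). Then ε₋ ≤ −1, with equality ε₋ = −1 if and only if Δ_g = 0. -/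
open Finset

theorem inertia_nonneg {E : Type*} [NormedAddCommGroup E] [InnerProductSpace ℝ E]
    {n : ℕ} (x : Fin n → E) {w : Fin n → ℝ} (hw : ∀ i, 0 ≤ w i) : 0 ≤ inertia x w := by
  unfold inertia inertiaAt
  exact Finset.sum_nonneg fun i _ => mul_nonneg (hw i) (sq_nonneg _)

/-- The smaller root of `D ε ^ 2 - (A - B - D) ε - A` is at most `-1`. -/
theorem smaller_root_le_neg_one {A B D : ℝ} (hB : 0 ≤ B) (hD : 0 < D) :
    ((A - B - D) - Real.sqrt ((A - B - D) ^ 2 + 4 * A * D)) / (2 * D) ≤ -1 := by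
  have h : A - B + D ≤ Real.sqrt ((A - B - D) ^ 2 + 4 * A * D) :=
    Real.le_sqrt_of_sq_le (by nlinarith [mul_nonneg hB hD.le])
  rw [div_le_iff₀ (by positivity)]
  linarith

/-- The smaller root of `D ε ^ 2 - (A - B - D) ε - A` equals `-1` exactly when `B = 0`. -/
theorem smaller_root_eq_neg_one_iff {A B D : ℝ} (hA : 0 ≤ A) (hB : 0 ≤ B) (hD : 0 < D) :
    ((A - B - D) - Real.sqrt ((A - B - D) ^ 2 + 4 * A * D)) / (2 * D) = -1 ↔ B = 0 := by
  rw [div_eq_iff (by positivity)]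
  constructor
  · intro h
    have hs : Real.sqrt ((A - B - D) ^ 2 + 4 * A * D) = A - B + D := by linarith
    have hsq := Real.sq_sqrt (show 0 ≤ (A - B - D) ^ 2 + 4 * A * D by positivity)
    rw [hs] at hsq
    have hBD : B * D = 0 := by linarith
    exact (mul_eq_zero.mp hBD).resolve_right hD.ne'
  · rintro rfl
    rw [show (A - 0 - D) ^ 2 + 4 * A * D = (A + D) ^ 2 by ring,
      Real.sqrt_sq (by positivity)]
    ring

/-- Polarization of the in-focus: the in-focus parameter
`ε₋ = (b − √(b² + 4 Δ_f D_{fg}))/(2 D_{fg})` satisfies `ε₋ ≤ −1`, with equality iff the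
group is dispersion-free (`Δ_g = 0`). -/
theorem inFocus_polarization {E : Type*} [NormedAddCommGroup E] [InnerProductSpace ℝ E]
    {n : ℕ} (x : Fin n → E) (f g : Fin n → ℝ)
    (hf : ∑ i, f i = 1) (hg : ∑ i, g i = 1)
    (hfpos : ∀ i, 0 < f i) (hgnonneg : ∀ i, 0 ≤ g i)
    (hD : 0 < ‖centroid x f - centroid x g‖ ^ 2) :
    (((inertia x f - inertia x g - ‖centroid x f - centroid x g‖ ^ 2) -
        Real.sqrt ((inertia x f - inertia x g - ‖centroid x f - centroid x g‖ ^ 2) ^ 2 +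
          4 * inertia x f * ‖centroid x f - centroid x g‖ ^ 2)) /
      (2 * ‖centroid x f - centroid x g‖ ^ 2) ≤ -1) ∧
    (((inertia x f - inertia x g - ‖centroid x f - centroid x g‖ ^ 2) -
        Real.sqrt ((inertia x f - inertia x g - ‖centroid x f - centroid x g‖ ^ 2) ^ 2 +
          4 * inertia x f * ‖centroid x f - centroid x g‖ ^ 2)) /
      (2 * ‖centroid x f - centroid x g‖ ^ 2) = -1 ↔ inertia x g = 0) := by
  have hA := inertia_nonneg x fun i => (hfpos i).le
  have hB := inertia_nonneg x hgnonneg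
  exact ⟨smaller_root_le_neg_one hB hD, smaller_root_eq_neg_one_iff hA hB hD⟩
end

section
/- Let f, g : Fin n → ℝ with ∑ᵢ fᵢ = 1, ∑ᵢ gᵢ = 1, fᵢ > 0 and gᵢ ≥ 0 for all i, and suppose D_{fg} := ‖x̄_f − x̄_g‖² > 0. With b := Δ_f − Δ_g − D_{fg}, ε₋ := (b − √(b² + 4 Δ_f D_{fg}))/(2 D_{fg}) and a₋ := x̄_f + ε₋ • (x̄_f − x̄_g), one has a₋ = x̄_g if and only if Δ_g = 0; that is, the in-focus coincides with the group centroid exactly when the group is dispersion-free. -/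
open Finset

/-- On the line `u + ε (u - v)` through distinct points, `v` has parameter `-1`. -/
theorem add_smul_sub_eq_right_iff {E : Type*} [AddCommGroup E] [Module ℝ E]
    {u v : E} (huv : u - v ≠ 0) (ε : ℝ) : u + ε • (u - v) = v ↔ ε = -1 := by
  have h : u + ε • (u - v) - v = (ε + 1) • (u - v) := by module
  rw [← sub_eq_zero, h, smul_eq_zero_iff_left huv, add_eq_zero_iff_eq_neg]

/-- `-1` is the smaller root of `D ε² - (F - G - D) ε - F` exactly when `G = 0`. -/
theorem quadratic_root_eq_neg_one_iff {F G D : ℝ} (hF : 0 ≤ F) (hD : 0 < D) :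
    ((F - G - D) - Real.sqrt ((F - G - D) ^ 2 + 4 * F * D)) / (2 * D) = -1 ↔ G = 0 := by
  have hdisc : (F - G - D) ^ 2 + 4 * F * D = (F - G + D) ^ 2 + 4 * G * D := by ring
  rw [div_eq_iff (by positivity)]
  constructor
  · intro h
    have hs := Real.sq_sqrt (show 0 ≤ (F - G - D) ^ 2 + 4 * F * D by positivity)
    rw [show Real.sqrt ((F - G - D) ^ 2 + 4 * F * D) = F - G + D by linarith, hdisc] at hs
    have hGD : G * D = 0 := by linarith
    exact (mul_eq_zero.mp hGD).resolve_right hD.ne'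
  · rintro rfl
    rw [hdisc, mul_zero, zero_mul, add_zero, Real.sqrt_sq (by linarith)]
    ring

/-- The in-focus `a₋ = x̄_f + ε₋ (x̄_f − x̄_g)` coincides with the group centroid `x̄_g`
exactly when the group is dispersion-free, i.e. `Δ_g = 0`. -/
theorem inFocus_eq_centroid_iff {E : Type*} [NormedAddCommGroup E] [InnerProductSpace ℝ E]
    {n : ℕ} (x : Fin n → E) (f g : Fin n → ℝ)
    (hf : ∑ i, f i = 1) (hg : ∑ i, g i = 1)
    (hfpos : ∀ i, 0 < f i) (hgnonneg : ∀ i, 0 ≤ g i)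
    (hD : 0 < ‖centroid x f - centroid x g‖ ^ 2) :
    centroid x f +
        (((inertia x f - inertia x g - ‖centroid x f - centroid x g‖ ^ 2) -
            Real.sqrt ((inertia x f - inertia x g - ‖centroid x f - centroid x g‖ ^ 2) ^ 2 +
              4 * inertia x f * ‖centroid x f - centroid x g‖ ^ 2)) /
          (2 * ‖centroid x f - centroid x g‖ ^ 2)) • (centroid x f - centroid x g) =
      centroid x g ↔ inertia x g = 0 := by
  have hne : centroid x f - centroid x g ≠ 0 := by
    intro h
    simp [h] at hD
  rw [add_smul_sub_eq_right_iff hne,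
    quadratic_root_eq_neg_one_iff (inertia_nonneg x fun i => (hfpos i).le) hD]
end

section
/- Fix real numbers F > 0 (the overall inertia Δ_f) and D > 0 (the squared distance between centroids), and for G ≥ 0 (the group inertia Δ_g) define b(G) := F − G − D, ε₋(G) := (b(G) − √(b(G)² + 4 F D))/(2D), and ε₊(G) := (b(G) + √(b(G)² + 4 F D))/(2D). Then both G ↦ ε₋(G) and G ↦ ε₊(G) are strictly decreasing on [0, ∞); in particular each attains its maximum value on [0, ∞) at G = 0, where ε₋(0) = −1 and ε₊(0) = F/D. -/
theorem Real.abs_sqrt_sq_add_sub_sqrt_sq_add_lt {c x y : ℝ} (hc : 0 < c) (hxy : x < y) :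
    |√(y ^ 2 + c) - √(x ^ 2 + c)| < y - x := by
  have hx : |x| < √(x ^ 2 + c) := Real.lt_sqrt_of_sq_lt (by rw [sq_abs]; linarith)
  have hy : |y| < √(y ^ 2 + c) := Real.lt_sqrt_of_sq_lt (by rw [sq_abs]; linarith)
  have hsx : √(x ^ 2 + c) ^ 2 = x ^ 2 + c := Real.sq_sqrt (by positivity)
  have hsy : √(y ^ 2 + c) ^ 2 = y ^ 2 + c := Real.sq_sqrt (by positivity)
  rw [abs_lt] at hx hy ⊢
  constructor
  · have h : √(x ^ 2 + c) < √(y ^ 2 + c) + (y - x) :=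
      lt_of_pow_lt_pow_left₀ 2 (by linarith)
        (by nlinarith [mul_pos (sub_pos.2 hxy) (neg_lt_iff_pos_add.1 hy.1)])
    linarith
  · have h : √(y ^ 2 + c) < √(x ^ 2 + c) + (y - x) :=
      lt_of_pow_lt_pow_left₀ 2 (by linarith)
        (by nlinarith [mul_pos (sub_pos.2 hxy) (sub_pos.2 hx.2)])
    linarith

theorem Real.strictMono_sub_sqrt_sq_add {c : ℝ} (hc : 0 < c) :
    StrictMono fun x : ℝ => x - √(x ^ 2 + c) := fun x y hxy => by
  have h := (abs_lt.1 (Real.abs_sqrt_sq_add_sub_sqrt_sq_add_lt hc hxy)).2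
  dsimp only
  linarith

theorem Real.strictMono_add_sqrt_sq_add {c : ℝ} (hc : 0 < c) :
    StrictMono fun x : ℝ => x + √(x ^ 2 + c) := fun x y hxy => by
  have h := (abs_lt.1 (Real.abs_sqrt_sq_add_sub_sqrt_sq_add_lt hc hxy)).1
  dsimp only
  linarith

/-- With the overall inertia `F > 0` and squared centroid distance `D > 0` fixed, both
focus parameters `ε₋` and `ε₊` are strictly decreasing functions of the group inertia
`G ≥ 0`; in particular each attains its maximum on `[0, ∞)` at `G = 0`, where
`ε₋(0) = −1` and `ε₊(0) = F/D`. -/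
theorem focus_params_strictAnti (F D : ℝ) (hF : 0 < F) (hD : 0 < D) :
    StrictAntiOn (fun G : ℝ =>
        ((F - G - D) - Real.sqrt ((F - G - D) ^ 2 + 4 * F * D)) / (2 * D)) (Set.Ici 0) ∧
    StrictAntiOn (fun G : ℝ =>
        ((F - G - D) + Real.sqrt ((F - G - D) ^ 2 + 4 * F * D)) / (2 * D)) (Set.Ici 0) ∧
    (∀ G : ℝ, 0 ≤ G →
        ((F - G - D) - Real.sqrt ((F - G - D) ^ 2 + 4 * F * D)) / (2 * D) ≤
          ((F - 0 - D) - Real.sqrt ((F - 0 - D) ^ 2 + 4 * F * D)) / (2 * D)) ∧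
    (∀ G : ℝ, 0 ≤ G →
        ((F - G - D) + Real.sqrt ((F - G - D) ^ 2 + 4 * F * D)) / (2 * D) ≤
          ((F - 0 - D) + Real.sqrt ((F - 0 - D) ^ 2 + 4 * F * D)) / (2 * D)) ∧
    ((F - 0 - D) - Real.sqrt ((F - 0 - D) ^ 2 + 4 * F * D)) / (2 * D) = -1 ∧
    ((F - 0 - D) + Real.sqrt ((F - 0 - D) ^ 2 + 4 * F * D)) / (2 * D) = F / D := by
  have hc : 0 < 4 * F * D := by positivity
  have hminus : StrictAnti fun G : ℝ =>
      ((F - G - D) - Real.sqrt ((F - G - D) ^ 2 + 4 * F * D)) / (2 * D) := fun G H hGH =>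
    div_lt_div_of_pos_right
      (Real.strictMono_sub_sqrt_sq_add hc (show F - H - D < F - G - D by linarith))
      (by positivity)
  have hplus : StrictAnti fun G : ℝ =>
      ((F - G - D) + Real.sqrt ((F - G - D) ^ 2 + 4 * F * D)) / (2 * D) := fun G H hGH =>
    div_lt_div_of_pos_right
      (Real.strictMono_add_sqrt_sq_add hc (show F - H - D < F - G - D by linarith))
      (by positivity)
  have hdisc : Real.sqrt ((F - 0 - D) ^ 2 + 4 * F * D) = F + D := by
    rw [show (F - 0 - D) ^ 2 + 4 * F * D = (F + D) ^ 2 by ring]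
    exact Real.sqrt_sq (by positivity)
  refine ⟨hminus.strictAntiOn _, hplus.strictAntiOn _, fun G hG => hminus.antitone hG,
    fun G hG => hplus.antitone hG, ?_, ?_⟩
  · rw [hdisc]
    field_simp
    ring
  · rw [hdisc]
    field_simp
    ring
end

section
/- (Squared polarization ratio) Let Δ_f ≥ 0, Δ_g ≥ 0 and D > 0 be real numbers, set b := Δ_f − Δ_g − D and ε_± := (b ± √(b² + 4 Δ_f D))/(2D). Then (ε₊ − ε₋)² = (1 + (Δ_f + Δ_g)/D)² − 4 Δ_f Δ_g / D² ≥ 1, and equality (ε₊ − ε₋)² = 1 holds if and only if Δ_f = 0 and Δ_g = 0. Moreover, in the geometric setting where a_± := x̄_f + ε_± • (x̄_f − x̄_g) with D = D_{fg} = ‖x̄_f − x̄_g‖², one has ‖a₊ − a₋‖² / D_{fg} = (ε₊ − ε₋)². -/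
open Finset

/-- In-focus parameter `ε₋ = (b − √(b² + 4FD))/(2D)` with `b = F − G − D`. -/
noncomputable def epsMinus (F G D : ℝ) : ℝ :=
  ((F - G - D) - Real.sqrt ((F - G - D) ^ 2 + 4 * F * D)) / (2 * D)

/-- Out-focus parameter `ε₊ = (b + √(b² + 4FD))/(2D)` with `b = F − G − D`. -/
noncomputable def epsPlus (F G D : ℝ) : ℝ :=
  ((F - G - D) + Real.sqrt ((F - G - D) ^ 2 + 4 * F * D)) / (2 * D)

universe u

theorem epsPlus_sub_epsMinus {F G D : ℝ} (hD : D ≠ 0) :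
    epsPlus F G D - epsMinus F G D = Real.sqrt ((F - G - D) ^ 2 + 4 * F * D) / D := by
  unfold epsPlus epsMinus
  field_simp
  ring

/-- Squared polarization ratio: `(ε₊ − ε₋)² = (1 + (Δ_f + Δ_g)/D)² − 4 Δ_f Δ_g / D² ≥ 1`,
with equality iff `Δ_f = Δ_g = 0`; moreover in the geometric setting
`‖a₊ − a₋‖² / D_{fg} = (ε₊ − ε₋)²`. -/
theorem squared_polarization_ratio (F G D : ℝ) (hF : 0 ≤ F) (hG : 0 ≤ G) (hD : 0 < D) :
    (epsPlus F G D - epsMinus F G D) ^ 2 =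
      (1 + (F + G) / D) ^ 2 - 4 * F * G / D ^ 2 ∧
    1 ≤ (epsPlus F G D - epsMinus F G D) ^ 2 ∧
    ((epsPlus F G D - epsMinus F G D) ^ 2 = 1 ↔ F = 0 ∧ G = 0) ∧
    (∀ (E : Type u) [NormedAddCommGroup E] [InnerProductSpace ℝ E] (n : ℕ)
        (x : Fin n → E) (f g : Fin n → ℝ),
      ∑ i, f i = 1 → ∑ i, g i = 1 →
      inertia x f = F → inertia x g = G →
      ‖centroid x f - centroid x g‖ ^ 2 = D →
      ‖(centroid x f + epsPlus F G D • (centroid x f - centroid x g)) -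
          (centroid x f + epsMinus F G D • (centroid x f - centroid x g))‖ ^ 2 / D =
        (epsPlus F G D - epsMinus F G D) ^ 2) := by
  have key : (epsPlus F G D - epsMinus F G D) ^ 2 = 1 + (2 * D * (F + G) + (F - G) ^ 2) / D ^ 2 := by
    rw [epsPlus_sub_epsMinus hD.ne', div_pow, Real.sq_sqrt (by positivity)]
    field_simp
    ring
  refine ⟨?_, ?_, ?_, ?_⟩
  · rw [key]
    field_simp
    ring
  · rw [key]
    exact le_add_of_nonneg_right (by positivity)
  · rw [key, add_eq_left, div_eq_zero_iff, or_iff_left (by positivity)]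
    constructor
    · intro h
      have hFG : F + G = 0 := by
        have h₁ : 0 ≤ D * (F + G) := by positivity
        have h₂ : D * (F + G) = 0 := by nlinarith [sq_nonneg (F - G)]
        exact (mul_eq_zero.mp h₂).resolve_left hD.ne'
      constructor <;> linarith
    · rintro ⟨rfl, rfl⟩
      simp
  · intro E _ _ n x f g _ _ _ _ hdist
    rw [add_sub_add_left_eq_sub, ← sub_smul, norm_smul, mul_pow, hdist, Real.norm_eq_abs, sq_abs,
      mul_div_cancel_right₀ _ hD.ne']
end

section
/- (Out-focus of a group is the in-focus of the complementary group) Let x : Fin n → E be points of a real inner product space and let f, g, ḡ : Fin n → ℝ with fᵢ > 0, gᵢ ≥ 0, ḡᵢ ≥ 0 for all i, ∑ᵢ gᵢ = 1, ∑ᵢ ḡᵢ = 1, f = ρ·g + (1 − ρ)·ḡ for some ρ ∈ (0, 1), and Δ_f > 0. Then a point a ∈ E is a global maximizer of δ(·|g,f) := Δ_g^·/Δ_f^· if and only if a is a global minimizer of δ(·|ḡ,f) := Δ_ḡ^·/Δ_f^·; more precisely, for all a, a' ∈ E, δ(a|g,f) ≥ δ(a'|g,f) if and only if δ(a|ḡ,f)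 ≤ δ(a'|ḡ,f). -/
open Finset

theorem inertiaAt_add_smul {E : Type*} [NormedAddCommGroup E] [InnerProductSpace ℝ E]
    {n : ℕ} (x : Fin n → E) (g h : Fin n → ℝ) (r s : ℝ) (a : E) :
    inertiaAt x (fun i => r * g i + s * h i) a = r * inertiaAt x g a + s * inertiaAt x h a := by
  simp only [inertiaAt, Finset.mul_sum, ← Finset.sum_add_distrib]
  exact Finset.sum_congr rfl fun i _ => by ring

theorem inertiaAt_pos_of_inertia_pos {E : Type*} [NormedAddCommGroup E] [InnerProductSpace ℝ E]
    {n : ℕ} {x : Fin n → E} {f : Fin n → ℝ} (hf : ∀ i, 0 < f i) (hsum : ∑ i, f i = 1)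
    (hpos : 0 < inertia x f) (a : E) : 0 < inertiaAt x f a := by
  have hnonneg : ∀ i ∈ Finset.univ, 0 ≤ f i * ‖x i - a‖ ^ 2 := fun i _ =>
    mul_nonneg (hf i).le (sq_nonneg _)
  refine (Finset.sum_nonneg hnonneg).lt_of_ne' fun hzero => hpos.ne' ?_
  have hx : ∀ i, x i = a := fun i => by
    have h := (Finset.sum_eq_zero_iff_of_nonneg hnonneg).1 hzero i (Finset.mem_univ i)
    simpa [(hf i).ne', sub_eq_zero] using h
  have hc : _root_.centroid x f = a := by
    simp [_root_.centroid, hx, ← Finset.sum_smul, hsum]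
  simp [inertia, inertiaAt, hc, hx]

/-- The out-focus of a group is the in-focus of the complementary group: a point globally
maximizes the relative dispersion of `g` in context `f` iff it globally minimizes the
relative dispersion of the complementary group `ḡ`; more precisely the order between
values of `δ(·|g,f)` is everywhere reversed for `δ(·|ḡ,f)`. -/
theorem outFocus_eq_inFocus_complement {E : Type*} [NormedAddCommGroup E]
    [InnerProductSpace ℝ E] {n : ℕ} (x : Fin n → E) (f g gbar : Fin n → ℝ) (ρ : ℝ)
    (hρ : ρ ∈ Set.Ioo (0 : ℝ) 1)
    (hfpos : ∀ i, 0 < f i) (hgnonneg : ∀ i, 0 ≤ g i) (hgbarnonneg : ∀ i, 0 ≤ gbar i)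
    (hg : ∑ i, g i = 1) (hgbar : ∑ i, gbar i = 1)
    (hmix : f = fun i => ρ * g i + (1 - ρ) * gbar i)
    (hΔf : 0 < inertia x f) :
    (∀ a : E,
      (∀ a' : E, relDisp x g f a' ≤ relDisp x g f a) ↔
        (∀ a' : E, relDisp x gbar f a ≤ relDisp x gbar f a')) ∧
    (∀ a a' : E,
      relDisp x g f a' ≤ relDisp x g f a ↔ relDisp x gbar f a ≤ relDisp x gbar f a') := by
  obtain ⟨hρ0, hρ1⟩ := hρ
  have hfsum : ∑ i, f i = 1 := by
    simp [hmix, Finset.sum_add_distrib, ← Finset.mul_sum, hg, hgbar]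
  have hrel (a : E) : ρ * relDisp x g f a + (1 - ρ) * relDisp x gbar f a = 1 := by
    have hpos := inertiaAt_pos_of_inertia_pos hfpos hfsum hΔf a
    have hlin : inertiaAt x f a = ρ * inertiaAt x g a + (1 - ρ) * inertiaAt x gbar a := by
      rw [hmix, inertiaAt_add_smul]
    rw [relDisp, relDisp, ← mul_div_assoc, ← mul_div_assoc, ← add_div, ← hlin,
      div_self hpos.ne']
  have hiff (a a' : E) :
      relDisp x g f a' ≤ relDisp x g f a ↔ relDisp x gbar f a ≤ relDisp x gbar f a' := by
    have ha := hrel a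
    have ha' := hrel a'
    rw [← mul_le_mul_iff_right₀ hρ0,
      ← mul_le_mul_iff_right₀ (b := relDisp x gbar f a) (sub_pos.2 hρ1)]
    constructor <;> intro h <;> linarith
  exact ⟨fun a => forall_congr' (hiff a), hiff⟩
end

section
/- (Decision-theoretic limit) Let x : Fin n → E be points of a real inner product space, let f, g : Fin n → ℝ with fᵢ > 0, gᵢ ≥ 0 for all i and ∑ᵢ fᵢ = ∑ᵢ gᵢ = 1, and fix a ∈ E with Δ_f^a := ∑ᵢ fᵢ‖xᵢ − a‖² > 0. For β > 0 set P(miss)(β) := ∑ᵢ gᵢ (1 − exp(−β‖xᵢ − a‖²)) and P(co.re.)(β) := ∑ᵢ fᵢ (1 − exp(−β‖xᵢ − a‖²)). Then P(co.re.)(β) > 0 for all β > 0, and the ratio P(miss)(β)/P(co.re.)(β) tends to Δ_g^a / Δ_f^a as β → 0 from the right, where Δ_g^a := ∑ᵢ gᵢ‖xᵢ − a‖². -/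
open Finset

theorem hasDerivAt_sum_mul_one_sub_exp {E : Type*} [NormedAddCommGroup E]
    [InnerProductSpace ℝ E] {n : ℕ} (x : Fin n → E) (w : Fin n → ℝ) (a : E) :
    HasDerivAt (fun β : ℝ => ∑ i, w i * (1 - Real.exp (-β * ‖x i - a‖ ^ 2)))
      (inertiaAt x w a) 0 := by
  unfold inertiaAt
  refine HasDerivAt.fun_sum fun i _ => ?_
  have h := ((((hasDerivAt_id (0 : ℝ)).neg.mul_const (‖x i - a‖ ^ 2)).exp).const_sub 1).const_mul
    (w i)
  simpa using h

theorem tendsto_inv_mul_sum_mul_one_sub_exp {E : Type*} [NormedAddCommGroup E]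
    [InnerProductSpace ℝ E] {n : ℕ} (x : Fin n → E) (w : Fin n → ℝ) (a : E) :
    Filter.Tendsto
      (fun β : ℝ => β⁻¹ * ∑ i, w i * (1 - Real.exp (-β * ‖x i - a‖ ^ 2)))
      (nhdsWithin 0 (Set.Ioi 0)) (nhds (inertiaAt x w a)) := by
  simpa using (hasDerivAt_sum_mul_one_sub_exp x w a).tendsto_slope_zero_right

theorem sum_mul_one_sub_exp_pos {E : Type*} [NormedAddCommGroup E]
    [InnerProductSpace ℝ E] {n : ℕ} {x : Fin n → E} {w : Fin n → ℝ} (hw : ∀ i, 0 ≤ w i)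
    {a : E} (hwa : 0 < inertiaAt x w a) {β : ℝ} (hβ : 0 < β) :
    0 < ∑ i, w i * (1 - Real.exp (-β * ‖x i - a‖ ^ 2)) := by
  obtain ⟨i, -, hi⟩ := Finset.exists_lt_of_sum_lt
    (show ∑ _i : Fin n, (0 : ℝ) < ∑ i, w i * ‖x i - a‖ ^ 2 by simpa [inertiaAt] using hwa)
  have hr : 0 < ‖x i - a‖ ^ 2 := pos_of_mul_pos_right hi (hw i)
  refine Finset.sum_pos' (fun j _ => mul_nonneg (hw j) ?_) ⟨i, Finset.mem_univ i, ?_⟩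
  · rw [sub_nonneg, Real.exp_le_one_iff, neg_mul, neg_nonpos]
    positivity
  · refine mul_pos (pos_of_mul_pos_left hi hr.le) ?_
    rw [sub_pos, Real.exp_lt_one_iff, neg_mul, neg_lt_zero]
    exact mul_pos hβ hr

/-- Decision-theoretic limit: with `P(miss)(β) = ∑ᵢ gᵢ(1 − e^{−β‖xᵢ−a‖²})` and
`P(co.re.)(β) = ∑ᵢ fᵢ(1 − e^{−β‖xᵢ−a‖²})`, the correct-rejection probability is positive
for every `β > 0`, and the ratio `P(miss)/P(co.re.)` tends to the relative dispersion
`Δ_g^a / Δ_f^a` as `β → 0⁺`. -/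
theorem decision_theoretic_limit {E : Type*} [NormedAddCommGroup E]
    [InnerProductSpace ℝ E] {n : ℕ} (x : Fin n → E) (f g : Fin n → ℝ)
    (hfpos : ∀ i, 0 < f i) (hgnonneg : ∀ i, 0 ≤ g i)
    (hf : ∑ i, f i = 1) (hg : ∑ i, g i = 1)
    (a : E) (hfa : 0 < inertiaAt x f a) :
    (∀ β : ℝ, 0 < β → 0 < ∑ i, f i * (1 - Real.exp (-β * ‖x i - a‖ ^ 2))) ∧
    Filter.Tendsto
      (fun β : ℝ =>
        (∑ i, g i * (1 - Real.exp (-β * ‖x i - a‖ ^ 2))) /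
          (∑ i, f i * (1 - Real.exp (-β * ‖x i - a‖ ^ 2))))
      (nhdsWithin 0 (Set.Ioi 0)) (nhds (inertiaAt x g a / inertiaAt x f a)) := by
  refine ⟨fun β hβ => sum_mul_one_sub_exp_pos (fun i => (hfpos i).le) hfa hβ, ?_⟩
  refine ((tendsto_inv_mul_sum_mul_one_sub_exp x g a).div
    (tendsto_inv_mul_sum_mul_one_sub_exp x f a) hfa.ne').congr' ?_
  filter_upwards [self_mem_nhdsWithin] with β hβ
  exact mul_div_mul_left _ _ (inv_ne_zero (ne_of_gt hβ))
end

section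
/- (Subtractive combination) Let x : Fin n → E be points of a real inner product space, let f, g : Fin n → ℝ with ∑ᵢ fᵢ = ∑ᵢ gᵢ = 1, and for λ ∈ ℝ define γ_λ(a) := (1 − λ) Δ_g^a − λ Δ_f^a, where Δ_w^a := ∑ᵢ wᵢ‖xᵢ − a‖². Let a* := x̄_f + ((λ − 1)/(1 − 2λ)) • (x̄_f − x̄_g). Then: if λ < 1/2, a* is the unique global minimizer of γ_λ (γ_λ(a*) < γ_λ(a) for all a ≠ a*); and if λ > 1/2, a* is the unique global maximizer of γ_λ (γ_λ(a*) > γ_λ(a) for all a ≠ a*). In particular the position of the extremum does not depend on the inertias Δ_f and Δ_g. -/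
open Finset

/-- The parallel axis theorem relative to an arbitrary base point. -/
theorem inertiaAt_eq_add_sq_sub_inner {E : Type*} [NormedAddCommGroup E]
    [InnerProductSpace ℝ E] {n : ℕ} (x : Fin n → E) (w : Fin n → ℝ) (hw : ∑ i, w i = 1)
    (a b : E) :
    inertiaAt x w a =
      inertiaAt x w b + ‖a - b‖ ^ 2 - 2 * inner ℝ (a - b) (centroid x w - b) := by
  have hsq : ∀ i, w i * ‖x i - a‖ ^ 2 =
      w i * ‖x i - b‖ ^ 2 + w i * ‖a - b‖ ^ 2 - 2 * inner ℝ (a - b) (w i • (x i - b)) := by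
    intro i
    rw [← sub_sub_sub_cancel_right (x i) a b, norm_sub_sq_real, real_inner_smul_right,
      real_inner_comm]
    ring
  have hc : ∑ i, w i • (x i - b) = centroid x w - b := by
    simp only [smul_sub, Finset.sum_sub_distrib, ← Finset.sum_smul, hw, one_smul, _root_.centroid]
  simp only [inertiaAt, hsq]
  rw [Finset.sum_sub_distrib, Finset.sum_add_distrib, ← Finset.sum_mul, hw, one_mul,
    ← Finset.mul_sum, ← inner_sum, hc]

theorem subtractive_combination_eq_add_sq {E : Type*} [NormedAddCommGroup E]
    [InnerProductSpace ℝ E] {n : ℕ} (x : Fin n → E) (f g : Fin n → ℝ)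
    (hf : ∑ i, f i = 1) (hg : ∑ i, g i = 1) (lam : ℝ) (hlam : 1 - 2 * lam ≠ 0) (a b : E)
    (hb : b = centroid x f + ((lam - 1) / (1 - 2 * lam)) • (centroid x f - centroid x g)) :
    (1 - lam) * inertiaAt x g a - lam * inertiaAt x f a =
      (1 - lam) * inertiaAt x g b - lam * inertiaAt x f b + (1 - 2 * lam) * ‖a - b‖ ^ 2 := by
  have hzero : (1 - lam) • (centroid x g - b) - lam • (centroid x f - b) = 0 := by
    have hr := div_mul_cancel₀ (lam - 1) hlam
    rw [hb]
    generalize (lam - 1) / (1 - 2 * lam) = r at hr ⊢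
    match_scalars
    · linear_combination hr
    · linear_combination -hr
  have hinner := congrArg (inner ℝ (a - b)) hzero
  rw [inner_sub_right, real_inner_smul_right, real_inner_smul_right, inner_zero_right] at hinner
  rw [inertiaAt_eq_add_sq_sub_inner x g hg a b, inertiaAt_eq_add_sq_sub_inner x f hf a b]
  linear_combination -2 * hinner

/-- Subtractive combination `γ_λ(a) = (1−λ) Δ_g^a − λ Δ_f^a`: for `λ < 1/2` the point
`a* = x̄_f + ((λ−1)/(1−2λ)) (x̄_f − x̄_g)` is the unique global minimizer of `γ_λ`, and for
`λ > 1/2` it is the unique global maximizer; in particular the position of the extremum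
does not depend on the inertias `Δ_f` and `Δ_g`. -/
theorem subtractive_combination_extremum {E : Type*} [NormedAddCommGroup E]
    [InnerProductSpace ℝ E] {n : ℕ} (x : Fin n → E) (f g : Fin n → ℝ)
    (hf : ∑ i, f i = 1) (hg : ∑ i, g i = 1) (lam : ℝ) :
    (lam < 1 / 2 →
      ∀ a : E,
        a ≠ centroid x f + ((lam - 1) / (1 - 2 * lam)) • (centroid x f - centroid x g) →
        (1 - lam) * inertiaAt x g
              (centroid x f + ((lam - 1) / (1 - 2 * lam)) • (centroid x f - centroid x g)) -
            lam * inertiaAt x f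
              (centroid x f + ((lam - 1) / (1 - 2 * lam)) • (centroid x f - centroid x g)) <
          (1 - lam) * inertiaAt x g a - lam * inertiaAt x f a) ∧
    (1 / 2 < lam →
      ∀ a : E,
        a ≠ centroid x f + ((lam - 1) / (1 - 2 * lam)) • (centroid x f - centroid x g) →
        (1 - lam) * inertiaAt x g a - lam * inertiaAt x f a <
          (1 - lam) * inertiaAt x g
              (centroid x f + ((lam - 1) / (1 - 2 * lam)) • (centroid x f - centroid x g)) -
            lam * inertiaAt x f
              (centroid x f + ((lam - 1) / (1 - 2 * lam)) • (centroid x f - centroid x g))) := by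
  refine ⟨fun h a ha => ?_, fun h a ha => ?_⟩
  all_goals
    have hpos := pow_pos (norm_pos_iff.mpr (sub_ne_zero.mpr ha)) 2
    have heq := subtractive_combination_eq_add_sq x f g hf hg lam (by grind) a _ rfl
  · have := mul_pos (by linarith : 0 < 1 - 2 * lam) hpos
    linarith
  · have := mul_neg_of_neg_of_pos (by linarith : 1 - 2 * lam < 0) hpos
    linarith
end
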